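/- arXiv:2403.06718 — 3 statements merged into one kernel-verified Lean document; each statement's English description precedes it below -/
import Mathlib

section
/- Fix integers m < r < s ≤ n with m ≥ 1, reals α, β ≥ 0 with m+α > 0, and x > 0 with x+β > 0. For θ > 0 let q_θ(y₁,y₂) = θ² [(n−m)!/((r−m−1)!(s−r−1)!(n−s)!)] (1−e^{−θy₁})^{r−m−1}(1−e^{−θy₂})^{s−r−1} e^{−θ((n−r+1)y₁+(n−s+1)y₂)}, and let π(θ|x) = (x+β)^{α+m} θ^{α+m−1} e^{−θ(x+β)}/Γ(α+m). Then for every (y₁,y₂) ∈ (0,∞)², ∫₀^∞ q_θ(y₁,y₂) π(θ|x) dθ = Σ_{i=0}^{r−m−1} Σ_{j=0}^{s−r−1} ω_{i,j} · g_{m+α, a_i/(x+β), b_j/(x+β)}(y₁,y₂), where a_i = n−r+i+1, b_j = n−s+j+1, and ω_{i,j} = [(n−m)!/(n−s)!] · (−1)^{i+j}/(i! j!) · 1/((r−m−i−1)!(s−r−j−1)!) · 1/(a_i b_j). -/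
open MeasureTheory Real

/-- Bivariate Pareto type II density on `(0,∞)²`:
`g_{m,h₁,h₂}(y₁,y₂) = m(m+1) h₁ h₂ (1 + h₁y₁ + h₂y₂)^{-(m+2)}`. -/
noncomputable def bivParetoPDF (m h₁ h₂ y₁ y₂ : ℝ) : ℝ :=
  if 0 < y₁ ∧ 0 < y₂ then
    m * (m + 1) * (h₁ * h₂) * (1 + h₁ * y₁ + h₂ * y₂) ^ (-(m + 2))
  else 0

/-- The `Gamma(a, c)` density. -/
noncomputable def gammaDensity (a c θ : ℝ) : ℝ :=
  c ^ a * θ ^ (a - 1) * Real.exp (-θ * c) / Real.Gamma a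

theorem gammaDensity_mul_sq_exp_eq {a c S θ : ℝ} (hθ : 0 < θ) :
    θ ^ 2 * Real.exp (-θ * S) * gammaDensity a c θ =
      c ^ a / Real.Gamma a * (θ ^ (a + 2 - 1) * Real.exp (-((c + S) * θ))) := by
  have h1 : θ ^ (a + 2 - 1) = θ ^ 2 * θ ^ (a - 1) := by
    rw [← Real.rpow_natCast θ 2, ← Real.rpow_add hθ]
    congr 1
    push_cast
    ring
  have h2 : Real.exp (-((c + S) * θ)) = Real.exp (-θ * S) * Real.exp (-θ * c) := by
    rw [← Real.exp_add]
    congr 1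
    ring
  rw [h1, h2, gammaDensity]
  ring

theorem integral_sq_mul_exp_mul_gammaDensity {a c S : ℝ} (ha : 0 < a) (hc : 0 < c)
    (hS : 0 < S) :
    ∫ θ in Set.Ioi (0 : ℝ), θ ^ 2 * Real.exp (-θ * S) * gammaDensity a c θ =
      a * (a + 1) / c ^ 2 * (1 + S / c) ^ (-(a + 2)) := by
  rw [setIntegral_congr_fun measurableSet_Ioi
      (fun θ hθ => gammaDensity_mul_sq_exp_eq (a := a) (c := c) (S := S) hθ),
    integral_const_mul, Real.integral_rpow_mul_exp_neg_mul_Ioi (by linarith) (by linarith)]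
  have hG : Real.Gamma (a + 2) = (a + 1) * (a * Real.Gamma a) := by
    rw [show a + 2 = a + 1 + 1 by ring, Real.Gamma_add_one (by linarith),
      Real.Gamma_add_one ha.ne']
  have hsplit : c + S = c * (1 + S / c) := by field_simp
  have hpos : 0 < 1 + S / c := by positivity
  have hpow : c ^ (a + 2) = c ^ a * c ^ 2 := by
    rw [Real.rpow_add hc]
    norm_cast
  have hGa := (Real.Gamma_pos_of_pos ha).ne'
  have hca := (Real.rpow_pos_of_pos hc a).ne'
  rw [hG, one_div, Real.inv_rpow (by linarith), hsplit, Real.mul_rpow hc.le hpos.le, hpow,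
    Real.rpow_neg hpos.le]
  field_simp

theorem integrableOn_sq_mul_exp_mul_gammaDensity {a c S : ℝ} (ha : 0 < a) (hc : 0 < c)
    (hS : 0 < S) :
    IntegrableOn (fun θ => θ ^ 2 * Real.exp (-θ * S) * gammaDensity a c θ) (Set.Ioi 0) := by
  refine Integrable.of_integral_ne_zero ?_
  rw [integral_sq_mul_exp_mul_gammaDensity ha hc hS]
  positivity

theorem integral_sq_mul_exp_mul_gammaDensity_eq_bivParetoPDF {a c A B y₁ y₂ : ℝ}
    (ha : 0 < a) (hc : 0 < c) (hA : 0 < A) (hB : 0 < B) (hy₁ : 0 < y₁) (hy₂ : 0 < y₂) :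
    ∫ θ in Set.Ioi (0 : ℝ), θ ^ 2 * Real.exp (-θ * (A * y₁ + B * y₂)) * gammaDensity a c θ =
      1 / (A * B) * bivParetoPDF a (A / c) (B / c) y₁ y₂ := by
  rw [integral_sq_mul_exp_mul_gammaDensity ha hc (by positivity), bivParetoPDF,
    if_pos ⟨hy₁, hy₂⟩,
    show 1 + (A * y₁ + B * y₂) / c = 1 + A / c * y₁ + B / c * y₂ by ring]
  field_simp

theorem one_sub_pow_div_factorial (p : ℕ) (u : ℝ) :
    (1 - u) ^ p / p.factorial =
      ∑ i ∈ Finset.range (p + 1), (-1) ^ i / (i.factorial * (p - i).factorial) * u ^ i := by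
  rw [sub_eq_neg_add, add_pow, Finset.sum_div]
  refine Finset.sum_congr rfl fun i hi => ?_
  rw [Nat.cast_choose ℝ (Finset.mem_range_succ_iff.mp hi), neg_pow]
  have := p.factorial_ne_zero
  field_simp
  simp

/-- The Bayes predictive density of `(Y₁, Y₂)` (Theorem 3.2): mixing the model density
`q_θ(y₁,y₂) = θ² (n-m)!/((r-m-1)!(s-r-1)!(n-s)!) (1-e^{-θy₁})^{r-m-1}(1-e^{-θy₂})^{s-r-1}
e^{-θ((n-r+1)y₁+(n-s+1)y₂)}` against the `Gamma(α+m, x+β)` posterior gives the mixture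
`Σ_{i=0}^{r-m-1} Σ_{j=0}^{s-r-1} ω_{i,j} g_{m+α, a_i/(x+β), b_j/(x+β)}(y₁,y₂)` of
bivariate Pareto densities, where `a_i = n-r+i+1`, `b_j = n-s+j+1` and
`ω_{i,j} = (n-m)!/(n-s)! · (-1)^{i+j}/(i!j!) · 1/((r-m-i-1)!(s-r-j-1)!) · 1/(a_i b_j)`. -/
theorem bayes_predictive_density_bivariate
    (n m r s : ℕ) (hm : 1 ≤ m) (hmr : m < r) (hrs : r < s) (hsn : s ≤ n)
    (α β : ℝ) (hα : 0 ≤ α) (hβ : 0 ≤ β) (hmα : 0 < (m : ℝ) + α)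
    (x : ℝ) (hx : 0 < x) (hxβ : 0 < x + β)
    (y₁ y₂ : ℝ) (hy₁ : 0 < y₁) (hy₂ : 0 < y₂) :
    (∫ θ in Set.Ioi (0 : ℝ),
        θ ^ 2 *
            (((n - m).factorial : ℝ) /
              ((r - m - 1).factorial * (s - r - 1).factorial * (n - s).factorial)) *
            (1 - Real.exp (-θ * y₁)) ^ (r - m - 1) * (1 - Real.exp (-θ * y₂)) ^ (s - r - 1) *
            Real.exp (-θ * (((n - r + 1 : ℕ) : ℝ) * y₁ + ((n - s + 1 : ℕ) : ℝ) * y₂)) *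
          ((x + β) ^ (α + m) * θ ^ (α + (m : ℝ) - 1) * Real.exp (-θ * (x + β)) /
            Real.Gamma (α + m))) =
      ∑ i ∈ Finset.range (r - m), ∑ j ∈ Finset.range (s - r),
        (((n - m).factorial : ℝ) / ((n - s).factorial : ℝ) *
            ((-1 : ℝ) ^ (i + j) / (i.factorial * j.factorial)) *
            (1 / ((r - m - i - 1).factorial * (s - r - j - 1).factorial)) *
            (1 / (((n - r + i + 1 : ℕ) : ℝ) * ((n - s + j + 1 : ℕ) : ℝ)))) *
          bivParetoPDF ((m : ℝ) + α) (((n - r + i + 1 : ℕ) : ℝ) / (x + β))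
            (((n - s + j + 1 : ℕ) : ℝ) / (x + β)) y₁ y₂ := by
  obtain ⟨p, rfl⟩ : ∃ p, r = m + p + 1 := ⟨r - m - 1, by omega⟩
  obtain ⟨q, rfl⟩ : ∃ q, s = m + p + 1 + q + 1 := ⟨s - (m + p + 1) - 1, by omega⟩
  have e1 : m + p + 1 - m = p + 1 := by omega
  have e2 : m + p + 1 + q + 1 - (m + p + 1) = q + 1 := by omega
  have e3 : ∀ k i : ℕ, k + 1 - i - 1 = k - i := by omega
  rw [e1, e2]
  simp only [e3, Nat.add_sub_cancel]
  generalize n - (m + p + 1) = k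
  generalize n - (m + p + 1 + q + 1) = l
  generalize n - m = N
  have ha : 0 < α + m := by linarith
  rw [add_comm (m : ℝ) α]
  generalize α + (m : ℝ) = a at *
  generalize x + β = c at *
  let w (i j : ℕ) : ℝ := (N.factorial : ℝ) / (l.factorial : ℝ) *
    ((-1 : ℝ) ^ (i + j) / (i.factorial * j.factorial)) *
    (1 / ((p - i).factorial * (q - j).factorial))
  let S (i j : ℕ) : ℝ := ((k + i + 1 : ℕ) : ℝ) * y₁ + ((l + j + 1 : ℕ) : ℝ) * y₂
  have hS (i j : ℕ) : 0 < S i j := by positivity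
  have hw (i j : ℕ) :
      IntegrableOn (fun θ => w i j * (θ ^ 2 * Real.exp (-θ * S i j) * gammaDensity a c θ))
        (Set.Ioi 0) :=
    (integrableOn_sq_mul_exp_mul_gammaDensity ha hxβ (hS i j)).const_mul _
  calc
    _ = ∫ θ in Set.Ioi (0 : ℝ), ∑ i ∈ Finset.range (p + 1), ∑ j ∈ Finset.range (q + 1),
          w i j * (θ ^ 2 * Real.exp (-θ * S i j) * gammaDensity a c θ) := by
      refine integral_congr_ae (.of_forall fun θ => ?_)
      have hexp (i j : ℕ) : Real.exp (-θ * S i j) =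
          Real.exp (-θ * y₁) ^ i * Real.exp (-θ * y₂) ^ j *
            Real.exp (-θ * (((k + 1 : ℕ) : ℝ) * y₁ + ((l + 1 : ℕ) : ℝ) * y₂)) := by
        rw [← Real.exp_nat_mul, ← Real.exp_nat_mul, ← Real.exp_add, ← Real.exp_add]
        congr 1
        simp only [S]
        push_cast
        ring
      simp only [hexp]
      generalize Real.exp (-θ * (((k + 1 : ℕ) : ℝ) * y₁ + ((l + 1 : ℕ) : ℝ) * y₂)) = E
      trans θ ^ 2 * (N.factorial / l.factorial) * E * gammaDensity a c θ *
        ((1 - Real.exp (-θ * y₁)) ^ p / p.factorial *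
          ((1 - Real.exp (-θ * y₂)) ^ q / q.factorial))
      · rw [gammaDensity]
        field_simp
      · rw [one_sub_pow_div_factorial, one_sub_pow_div_factorial, Finset.sum_mul_sum,
          Finset.mul_sum]
        refine Finset.sum_congr rfl fun i _ => ?_
        rw [Finset.mul_sum]
        refine Finset.sum_congr rfl fun j _ => ?_
        simp only [w, pow_add]
        field_simp
    _ = _ := by
      rw [integral_finsetSum _ fun i _ => integrable_finsetSum _ fun j _ => hw i j]
      refine Finset.sum_congr rfl fun i _ => ?_
      rw [integral_finsetSum _ fun j _ => hw i j]
      refine Finset.sum_congr rfl fun j _ => ?_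
      rw [integral_const_mul, integral_sq_mul_exp_mul_gammaDensity_eq_bivParetoPDF ha hxβ
        (by positivity) (by positivity) hy₁ hy₂, ← mul_assoc]
end

section
/- Fix integers m < r < s ≤ n with m ≥ 1 and r ≤ n−1, reals α, β ≥ 0 with m+α > 0, and x > 0 with x+β > 0. Let q̂(y₁,y₂) = Σ_{i=0}^{r−m−1} Σ_{j=0}^{s−r−1} ω_{i,j} g_{m+α, a_i/(x+β), b_j/(x+β)}(y₁,y₂), with a_i = n−r+i+1, b_j = n−s+j+1, ω_{i,j} = [(n−m)!/(n−s)!](−1)^{i+j}/(i!j!) · 1/((r−m−i−1)!(s−r−j−1)!) · 1/(a_i b_j). Then for every y₁ > 0, the marginal density satisfies ∫₀^∞ q̂(y₁,y₂) dy₂ = Σ_{i=0}^{r−m−1} γ_{n−r+1, r−m, i} · f_{m+α, a_i/(x+β)}(y₁), where γ_{c,d,k} = [Γ(c+d)/Γ(c)](−1)^k/(k!(d−1−k)!) · 1/(c+k). -/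
open MeasureTheory Real

/-- Univariate Pareto type II density: `f_{ℓ,h}(t) = ℓ h (1 + h t)^{-(ℓ+1)}` for `t > 0`. -/
noncomputable def paretoPDF (ℓ h t : ℝ) : ℝ :=
  if 0 < t then ℓ * h * (1 + h * t) ^ (-(ℓ + 1)) else 0

/-- `γ_{c,d,k} = Γ(c+d)/Γ(c) · (-1)^k/(k!(d-1-k)!) · 1/(c+k)`. -/
noncomputable def gammaWeight (c : ℝ) (d k : ℕ) : ℝ :=
  Real.Gamma (c + d) / Real.Gamma c *
    ((-1 : ℝ) ^ k / (k.factorial * (d - 1 - k).factorial)) * (1 / (c + k))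

theorem hasDerivAt_bivPareto_antideriv {p h₁ h₂ y₁ y : ℝ}
    (hbase : 0 < 1 + h₁ * y₁ + h₂ * y) :
    HasDerivAt (fun t : ℝ => -(p * h₁) * (1 + h₁ * y₁ + h₂ * t) ^ (-(p + 1)))
      (p * (p + 1) * (h₁ * h₂) * (1 + h₁ * y₁ + h₂ * y) ^ (-(p + 2))) y := by
  have hlin : HasDerivAt (fun t : ℝ => 1 + h₁ * y₁ + h₂ * t) h₂ y := by
    simpa using ((hasDerivAt_id y).const_mul h₂).const_add (1 + h₁ * y₁)
  refine ((hlin.rpow_const (p := -(p + 1)) (Or.inl hbase.ne')).const_mul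
    (-(p * h₁))).congr_deriv ?_
  rw [show -(p + 1) - 1 = -(p + 2) by ring]
  ring

theorem tendsto_bivPareto_antideriv {p h₂ : ℝ} (h₁ y₁ : ℝ) (hp : 0 < p) (hh₂ : 0 < h₂) :
    Filter.Tendsto (fun t : ℝ => -(p * h₁) * (1 + h₁ * y₁ + h₂ * t) ^ (-(p + 1)))
      Filter.atTop (nhds 0) := by
  have hlin : Filter.Tendsto (fun t : ℝ => 1 + h₁ * y₁ + h₂ * t) Filter.atTop Filter.atTop :=
    Filter.tendsto_atTop_add_const_left _ _ (Filter.tendsto_id.const_mul_atTop hh₂)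
  simpa using ((tendsto_rpow_neg_atTop (by linarith : 0 < p + 1)).comp hlin).const_mul (-(p * h₁))

/-- The bivariate Pareto density is integrable in its second argument. -/
theorem integrableOn_bivParetoPDF {p h₁ h₂ y₁ : ℝ} (hp : 0 < p) (hh₁ : 0 < h₁) (hh₂ : 0 < h₂)
    (hy₁ : 0 < y₁) : IntegrableOn (bivParetoPDF p h₁ h₂ y₁) (Set.Ioi 0) := by
  have hbase : ∀ y : ℝ, 0 ≤ y → 0 < 1 + h₁ * y₁ + h₂ * y := fun y hy => by positivity
  refine (integrableOn_Ioi_deriv_of_nonneg'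
    (fun y hy => hasDerivAt_bivPareto_antideriv (p := p) (hbase y hy)) (fun y hy => ?_)
    (tendsto_bivPareto_antideriv h₁ y₁ hp hh₂)).congr_fun (fun y hy => ?_) measurableSet_Ioi
  · have := hbase y (le_of_lt hy)
    positivity
  · simp only [bivParetoPDF]
    rw [if_pos ⟨hy₁, hy⟩]

/-- The first marginal of the bivariate Pareto density is a univariate Pareto density. -/
theorem integral_bivParetoPDF {p h₁ h₂ y₁ : ℝ} (hp : 0 < p) (hh₁ : 0 < h₁) (hh₂ : 0 < h₂)
    (hy₁ : 0 < y₁) : ∫ y in Set.Ioi 0, bivParetoPDF p h₁ h₂ y₁ y = paretoPDF p h₁ y₁ := by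
  have hbase : ∀ y : ℝ, 0 ≤ y → 0 < 1 + h₁ * y₁ + h₂ * y := fun y hy => by positivity
  rw [setIntegral_congr_fun (g := fun y =>
      p * (p + 1) * (h₁ * h₂) * (1 + h₁ * y₁ + h₂ * y) ^ (-(p + 2))) measurableSet_Ioi
      fun y hy => by simp only [bivParetoPDF]; rw [if_pos ⟨hy₁, hy⟩],
    integral_Ioi_of_hasDerivAt_of_nonneg'
      (fun y hy => hasDerivAt_bivPareto_antideriv (p := p) (hbase y hy)) (fun y hy => ?_)
      (tendsto_bivPareto_antideriv h₁ y₁ hp hh₂), paretoPDF, if_pos hy₁]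
  · simp
  · have := hbase y (le_of_lt hy)
    positivity

/-- Partial fraction expansion of `1 / (c (c + 1) ⋯ (c + N))`. -/
theorem sum_neg_one_pow_mul_choose_div_add (N : ℕ) {c : ℝ} (hc : 0 < c) :
    ∑ j ∈ Finset.range (N + 1), (-1 : ℝ) ^ j * (N.choose j) / (c + j) =
      N.factorial / ∏ k ∈ Finset.range (N + 1), (c + k) := by
  induction N generalizing c with
  | zero => simp
  | succ N ih =>
    have hsplit : ∑ j ∈ Finset.range (N + 2), (-1 : ℝ) ^ j * ((N + 1).choose j) / (c + j) =
        ∑ j ∈ Finset.range (N + 1), (-1 : ℝ) ^ j * (N.choose j) / (c + j) -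
          ∑ j ∈ Finset.range (N + 1), (-1 : ℝ) ^ j * (N.choose j) / (c + 1 + j) := by
      have hlast : ∑ j ∈ Finset.range (N + 1), (-1 : ℝ) ^ j * (N.choose j) / (c + j) =
          ∑ j ∈ Finset.range (N + 2), (-1 : ℝ) ^ j * (N.choose j) / (c + j) := by
        simp [Finset.sum_range_succ _ (N + 1)]
      rw [hlast, Finset.sum_range_succ', Finset.sum_range_succ' _ (N + 1), add_sub_right_comm,
        ← Finset.sum_sub_distrib]
      congr 1
      · refine Finset.sum_congr rfl fun j _ => ?_
        rw [Nat.choose_succ_succ]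
        push_cast
        rw [show c + 1 + (j : ℝ) = c + (j + 1) by ring]
        ring
      · simp
    have hpos : 0 < ∏ k ∈ Finset.range N, (c + 1 + (k : ℝ)) :=
      Finset.prod_pos fun k _ => by positivity
    have hshift : ∀ M : ℕ, ∏ k ∈ Finset.range (M + 1), (c + (k : ℝ)) =
        (∏ k ∈ Finset.range M, (c + 1 + (k : ℝ))) * c := fun M => by
      rw [Finset.prod_range_succ']
      simp only [Nat.cast_add, Nat.cast_one, Nat.cast_zero, add_zero, add_assoc,
        add_comm (1 : ℝ)]
    rw [hsplit, ih hc, ih (by positivity : 0 < c + 1), hshift, hshift, Finset.prod_range_succ,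
      Nat.factorial_succ]
    have hN : 0 < c + 1 + (N : ℝ) := by positivity
    push_cast
    field_simp
    ring

/-- Factorial form of the partial fraction expansion at a positive integer. -/
theorem sum_neg_one_pow_div_factorial_mul (N k : ℕ) :
    ∑ j ∈ Finset.range (N + 1),
        (-1 : ℝ) ^ j / (j.factorial * (N - j).factorial * ((k + j + 1 : ℕ) : ℝ)) =
      k.factorial / (k + N + 1).factorial := by
  have hprod : (k.factorial : ℝ) * ∏ i ∈ Finset.range (N + 1), ((k : ℝ) + 1 + i) =
      (k + N + 1).factorial := by
    have h := Nat.factorial_mul_ascFactorial k (N + 1)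
    rw [Nat.ascFactorial_eq_prod_range] at h
    exact_mod_cast h
  have hpos : 0 < ∏ i ∈ Finset.range (N + 1), ((k : ℝ) + 1 + i) :=
    Finset.prod_pos fun i _ => by positivity
  have hNf : (N.factorial : ℝ) ≠ 0 := by positivity
  have hkf : (k.factorial : ℝ) ≠ 0 := by positivity
  have hsum := sum_neg_one_pow_mul_choose_div_add N (c := (k : ℝ) + 1) (by positivity)
  have hterm : ∀ j ∈ Finset.range (N + 1),
      (-1 : ℝ) ^ j / (j.factorial * (N - j).factorial * ((k + j + 1 : ℕ) : ℝ)) =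
        (1 / N.factorial) * ((-1 : ℝ) ^ j * (N.choose j) / ((k : ℝ) + 1 + j)) := fun j hj => by
    rw [Nat.cast_choose ℝ (Nat.le_of_lt_succ (Finset.mem_range.mp hj))]
    push_cast
    have : (k : ℝ) + 1 + j ≠ 0 := by positivity
    rw [show (k : ℝ) + j + 1 = k + 1 + j by ring]
    field_simp
  rw [Finset.sum_congr rfl hterm, ← Finset.mul_sum, hsum, ← hprod]
  field_simp

/-- Marginalizing the bivariate Bayes predictive density
`q̂(y₁,y₂) = Σ_{i,j} ω_{i,j} g_{m+α, a_i/(x+β), b_j/(x+β)}(y₁,y₂)` over `y₂` yields the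
mixture of univariate Pareto densities
`Σ_{i=0}^{r-m-1} γ_{n-r+1, r-m, i} f_{m+α, a_i/(x+β)}(y₁)`. -/
theorem bayes_predictive_marginal_density
    (n m r s : ℕ) (hm : 1 ≤ m) (hmr : m < r) (hrs : r < s) (hsn : s ≤ n) (hr : r ≤ n - 1)
    (α β : ℝ) (hα : 0 ≤ α) (hβ : 0 ≤ β) (hmα : 0 < (m : ℝ) + α)
    (x : ℝ) (hx : 0 < x) (hxβ : 0 < x + β)
    (y₁ : ℝ) (hy₁ : 0 < y₁) :
    (∫ y₂ in Set.Ioi (0 : ℝ),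
        ∑ i ∈ Finset.range (r - m), ∑ j ∈ Finset.range (s - r),
          (((n - m).factorial : ℝ) / ((n - s).factorial : ℝ) *
              ((-1 : ℝ) ^ (i + j) / (i.factorial * j.factorial)) *
              (1 / ((r - m - i - 1).factorial * (s - r - j - 1).factorial)) *
              (1 / (((n - r + i + 1 : ℕ) : ℝ) * ((n - s + j + 1 : ℕ) : ℝ)))) *
            bivParetoPDF ((m : ℝ) + α) (((n - r + i + 1 : ℕ) : ℝ) / (x + β))
              (((n - s + j + 1 : ℕ) : ℝ) / (x + β)) y₁ y₂) =
      ∑ i ∈ Finset.range (r - m),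
        gammaWeight ((n - r + 1 : ℕ) : ℝ) (r - m) i *
          paretoPDF ((m : ℝ) + α) (((n - r + i + 1 : ℕ) : ℝ) / (x + β)) y₁ := by
  have hint : ∀ i j : ℕ, IntegrableOn (bivParetoPDF ((m : ℝ) + α)
      (((n - r + i + 1 : ℕ) : ℝ) / (x + β)) (((n - s + j + 1 : ℕ) : ℝ) / (x + β)) y₁)
      (Set.Ioi 0) := fun i j =>
    integrableOn_bivParetoPDF hmα (by positivity) (by positivity) hy₁
  rw [integral_finsetSum _ fun i _ => integrable_finsetSum _ fun j _ => (hint i j).const_mul _]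
  refine Finset.sum_congr rfl fun i _ => ?_
  rw [integral_finsetSum _ fun j _ => (hint i j).const_mul _]
  simp_rw [integral_const_mul]
  rw [Finset.sum_congr rfl fun j _ => by
    rw [integral_bivParetoPDF hmα (by positivity) (by positivity) hy₁], ← Finset.sum_mul]
  congr 1
  obtain ⟨N, hN⟩ : ∃ N, s - r = N + 1 := ⟨s - r - 1, by omega⟩
  have hkN : n - s + N + 1 = n - r := by omega
  have hsum := sum_neg_one_pow_div_factorial_mul N (n - s)
  rw [hkN] at hsum
  have hΓ₁ : Real.Gamma (((n - r + 1 : ℕ) : ℝ) + (r - m : ℕ)) = (n - m).factorial := by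
    rw [← Real.Gamma_nat_eq_factorial]
    congr 1
    exact_mod_cast (by omega : n - r + 1 + (r - m) = n - m + 1)
  have hΓ₂ : Real.Gamma ((n - r + 1 : ℕ) : ℝ) = (n - r).factorial := by
    rw [← Real.Gamma_nat_eq_factorial]
    push_cast
    rfl
  have hs : ((n - s).factorial : ℝ) ≠ 0 := by positivity
  rw [gammaWeight, hΓ₁, hΓ₂, hN, show r - m - 1 - i = r - m - i - 1 by omega]
  trans ((n - m).factorial : ℝ) / (n - s).factorial *
      ((-1) ^ i / (i.factorial * (r - m - i - 1).factorial)) *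
      (1 / ((n - r + i + 1 : ℕ) : ℝ)) * ((n - s).factorial / (n - r).factorial)
  · rw [← hsum, Finset.mul_sum]
    refine Finset.sum_congr rfl fun j _ => ?_
    rw [show N + 1 - j - 1 = N - j by omega, pow_add]
    field_simp
  · rw [show ((n - r + 1 : ℕ) : ℝ) + i = ((n - r + i + 1 : ℕ) : ℝ) by push_cast; ring]
    field_simp
end

section
/- Fix integers m < r < s ≤ n with m ≥ 1, reals α, β ≥ 0 with m+α > 0, and x > 0 with x+β > 0. With a_i = n−r+i+1, b_j = n−s+j+1, ω_{i,j} = [(n−m)!/(n−s)!](−1)^{i+j}/(i!j!) · 1/((r−m−i−1)!(s−r−j−1)!) · 1/(a_i b_j), and γ_{c,d,k} = [Γ(c+d)/Γ(c)](−1)^k/(k!(d−1−k)!) · 1/(c+k), the bivariate predictive density q̂(y₁,y₂) = Σ_{i,j} ω_{i,j} g_{m+α, a_i/(x+β), b_j/(x+β)}(y₁,y₂) factors, for every y₁ > 0, as q̂(y₁,y₂) = [Σ_i γ_{n−r+1,r−m,i} f_{m+α, a_i/(x+β)}(y₁)] · [Σ_{i=0}^{r−m−1} Σ_{j=0}^{s−r−1}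 α_i(y₁) β_j f_{m+α+1, b_j/(x+β+a_i y₁)}(y₂)], where β_j = γ_{n−s+1,s−r,j} and α_i(y₁) = γ_{n−r+1,r−m,i} f_{m+α, a_i/(x+β)}(y₁) / Σ_k γ_{n−r+1,r−m,k} f_{m+α, a_k/(x+β)}(y₁); that is, the conditional density of Y₂ given Y₁ = y₁ under q̂ is the mixture Σ_{i,j} α_i(y₁) β_j f_{m+α+1, b_j/(x+β+a_i y₁)}(y₂). -/
open MeasureTheory Real

/-- The alternating binomial sums of `u ↦ u ^ (-p)` along an arithmetic progression are positive. -/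
theorem sum_neg_one_pow_choose_mul_rpow_neg_pos {p u h : ℝ} (hp : 0 < p) (hu : 0 < u)
    (hh : 0 < h) (k : ℕ) :
    0 < ∑ i ∈ Finset.range (k + 1), (-1 : ℝ) ^ i * (k.choose i : ℝ) * (u + i * h) ^ (-p) := by
  have hΓ := Real.Gamma_pos_of_pos hp
  have hpos (i : ℕ) : 0 < u + i * h := by positivity
  have hint (i : ℕ) : ∫ z in Set.Ioi (0 : ℝ), z ^ (p - 1) * exp (-((u + i * h) * z)) =
      (u + i * h) ^ (-p) * Gamma p := by
    rw [Real.integral_rpow_mul_exp_neg_mul_Ioi hp (hpos i), one_div,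
      Real.inv_rpow (hpos i).le, Real.rpow_neg (hpos i).le]
  have hintble (i : ℕ) : Integrable (fun z : ℝ => z ^ (p - 1) * exp (-((u + i * h) * z)))
      (volume.restrict (Set.Ioi 0)) := by
    apply Integrable.of_integral_ne_zero
    rw [hint]
    exact (mul_pos (Real.rpow_pos_of_pos (hpos i) _) hΓ).ne'
  have hbinom (z : ℝ) : ∑ i ∈ Finset.range (k + 1),
      ((-1 : ℝ) ^ i * (k.choose i : ℝ)) * (z ^ (p - 1) * exp (-((u + i * h) * z))) =
      z ^ (p - 1) * exp (-(u * z)) * (1 - exp (-(h * z))) ^ k := by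
    rw [sub_eq_neg_add 1, add_pow, Finset.mul_sum]
    refine Finset.sum_congr rfl fun i _ => ?_
    have : exp (-((u + i * h) * z)) = exp (-(u * z)) * exp (-(h * z)) ^ i := by
      rw [← Real.exp_nat_mul, ← Real.exp_add]
      ring_nf
    rw [this, neg_pow (exp _)]
    ring
  have hsum_int := integrable_finsetSum (Finset.range (k + 1)) fun i _ =>
    (hintble i).const_mul ((-1 : ℝ) ^ i * (k.choose i : ℝ))
  have hsum := integral_finsetSum (Finset.range (k + 1)) fun i _ =>
    (hintble i).const_mul ((-1 : ℝ) ^ i * (k.choose i : ℝ))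
  simp only [integral_const_mul, hint, hbinom] at hsum hsum_int
  have hfpos (z : ℝ) (hz : z ∈ Set.Ioi (0 : ℝ)) :
      0 < z ^ (p - 1) * exp (-(u * z)) * (1 - exp (-(h * z))) ^ k := by
    have hz' : 0 < z := hz
    have : exp (-(h * z)) < 1 := by
      simpa using mul_pos hh hz'
    have : 0 < 1 - exp (-(h * z)) := by linarith
    positivity
  have hI : 0 < ∫ z in Set.Ioi (0 : ℝ),
      z ^ (p - 1) * exp (-(u * z)) * (1 - exp (-(h * z))) ^ k := by
    rw [setIntegral_pos_iff_support_of_nonneg_ae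
      ((ae_restrict_mem measurableSet_Ioi).mono fun z hz => (hfpos z hz).le) hsum_int]
    rw [Set.inter_eq_right.mpr fun z hz => Function.mem_support.mpr (hfpos z hz).ne']
    simp
  rw [hsum] at hI
  refine pos_of_mul_pos_left (b := Gamma p) ?_ hΓ.le
  rw [Finset.sum_mul]
  simpa only [mul_assoc] using hI

/-- The signed Pareto mixture with weights `γ_{c,d,k}` and scales `(c + k) / X` is positive. -/
theorem sum_gammaWeight_mul_paretoPDF_pos {c M X y : ℝ} {d : ℕ} (hc : 0 < c) (hd : 0 < d)
    (hM : 0 < M) (hX : 0 < X) (hy : 0 < y) :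
    0 < ∑ k ∈ Finset.range d, gammaWeight c d k * paretoPDF M ((c + k) / X) y := by
  obtain ⟨e, rfl⟩ : ∃ e, d = e + 1 := ⟨d - 1, by omega⟩
  have h := sum_neg_one_pow_choose_mul_rpow_neg_pos (p := M + 1) (u := 1 + c * (y / X))
    (h := y / X) (by positivity) (by positivity) (by positivity) e
  have hG : 0 < Gamma (c + (e + 1 : ℕ)) / Gamma c * (M / X) / e.factorial := by
    have := Real.Gamma_pos_of_pos hc
    have : 0 < Gamma (c + (e + 1 : ℕ)) := Real.Gamma_pos_of_pos (by positivity)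
    positivity
  refine (mul_pos hG h).trans_eq ?_
  rw [Finset.mul_sum]
  refine Finset.sum_congr rfl fun k hk => ?_
  have hke : k ≤ e := Nat.lt_succ_iff.mp (Finset.mem_range.mp hk)
  have hck : c + k ≠ 0 := by positivity
  have hbase : 1 + (c + k) / X * y = 1 + c * (y / X) + k * (y / X) := by ring
  rw [gammaWeight, paretoPDF, if_pos hy, hbase, Nat.cast_choose ℝ hke, Nat.add_sub_cancel]
  have := Nat.factorial_ne_zero e
  field_simp

/-- The bivariate Pareto density is the product of its first marginal and the conditional
density of the second coordinate. -/
theorem bivParetoPDF_eq_mul_paretoPDF {M a b X y₁ y₂ : ℝ} (ha : 0 < a) (hb : 0 < b) (hX : 0 < X)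
    (hy₁ : 0 < y₁) (hy₂ : 0 < y₂) :
    bivParetoPDF M (a / X) (b / X) y₁ y₂ =
      paretoPDF M (a / X) y₁ * paretoPDF (M + 1) (b / (X + a * y₁)) y₂ := by
  rw [bivParetoPDF, paretoPDF, paretoPDF, if_pos ⟨hy₁, hy₂⟩, if_pos hy₁, if_pos hy₂]
  have hA : 0 < 1 + a / X * y₁ := by positivity
  have hB : 0 < 1 + a / X * y₁ + b / X * y₂ := by positivity
  have hXA : X + a * y₁ = X * (1 + a / X * y₁) := by field_simp
  rw [hXA]
  generalize 1 + a / X * y₁ = A at hA hB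
  have hbase : 1 + b / (X * A) * y₂ = (A + b / X * y₂) / A := by field_simp
  rw [hbase, show -(M + 1 + 1) = -(M + 2) by ring, Real.div_rpow hB.le hA.le,
    show -(M + 1) = -(M + 2) + 1 by ring, Real.rpow_add_one hA.ne']
  have := (Real.rpow_pos_of_pos hA (-(M + 2))).ne'
  field_simp

/-- `γ_{c+1,d,k}` for a natural number `c`, with the Gamma quotient written by factorials. -/
theorem gammaWeight_natCast_add_one (c d k : ℕ) :
    gammaWeight ((c + 1 : ℕ) : ℝ) d k = ((c + d).factorial : ℝ) / c.factorial *
      ((-1 : ℝ) ^ k / (k.factorial * (d - 1 - k).factorial)) * (1 / ((c + k + 1 : ℕ) : ℝ)) := by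
  have h : ((c + 1 : ℕ) : ℝ) + d = ((c + d : ℕ) : ℝ) + 1 := by push_cast; ring
  have h' : ((c + 1 : ℕ) : ℝ) + k = ((c + k + 1 : ℕ) : ℝ) := by push_cast; ring
  rw [gammaWeight, h, h', Real.Gamma_nat_eq_factorial, Nat.cast_add_one,
    Real.Gamma_nat_eq_factorial]

/-- The bivariate Bayes predictive density
`q̂(y₁,y₂) = Σ_{i,j} ω_{i,j} g_{m+α, a_i/(x+β), b_j/(x+β)}(y₁,y₂)` factors, for `y₁ > 0`,
as the marginal `Σ_i γ_{n-r+1,r-m,i} f_{m+α,a_i/(x+β)}(y₁)` times the conditional mixture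
`Σ_{i,j} α_i(y₁) β_j f_{m+α+1, b_j/(x+β+a_i y₁)}(y₂)`, where `β_j = γ_{n-s+1,s-r,j}` and
`α_i(y₁) ∝ γ_{n-r+1,r-m,i} f_{m+α,a_i/(x+β)}(y₁)` with `Σ_i α_i(y₁) = 1`. -/
theorem bayes_predictive_conditional_mixture
    (n m r s : ℕ) (hm : 1 ≤ m) (hmr : m < r) (hrs : r < s) (hsn : s ≤ n)
    (α β : ℝ) (hα : 0 ≤ α) (hβ : 0 ≤ β) (hmα : 0 < (m : ℝ) + α)
    (x : ℝ) (hx : 0 < x) (hxβ : 0 < x + β)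
    (y₁ y₂ : ℝ) (hy₁ : 0 < y₁) (hy₂ : 0 < y₂) :
    (∑ i ∈ Finset.range (r - m), ∑ j ∈ Finset.range (s - r),
        (((n - m).factorial : ℝ) / ((n - s).factorial : ℝ) *
            ((-1 : ℝ) ^ (i + j) / (i.factorial * j.factorial)) *
            (1 / ((r - m - i - 1).factorial * (s - r - j - 1).factorial)) *
            (1 / (((n - r + i + 1 : ℕ) : ℝ) * ((n - s + j + 1 : ℕ) : ℝ)))) *
          bivParetoPDF ((m : ℝ) + α) (((n - r + i + 1 : ℕ) : ℝ) / (x + β))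
            (((n - s + j + 1 : ℕ) : ℝ) / (x + β)) y₁ y₂) =
      (∑ i ∈ Finset.range (r - m),
          gammaWeight ((n - r + 1 : ℕ) : ℝ) (r - m) i *
            paretoPDF ((m : ℝ) + α) (((n - r + i + 1 : ℕ) : ℝ) / (x + β)) y₁) *
        (∑ i ∈ Finset.range (r - m), ∑ j ∈ Finset.range (s - r),
          (gammaWeight ((n - r + 1 : ℕ) : ℝ) (r - m) i *
              paretoPDF ((m : ℝ) + α) (((n - r + i + 1 : ℕ) : ℝ) / (x + β)) y₁ /
              ∑ k ∈ Finset.range (r - m),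
                gammaWeight ((n - r + 1 : ℕ) : ℝ) (r - m) k *
                  paretoPDF ((m : ℝ) + α) (((n - r + k + 1 : ℕ) : ℝ) / (x + β)) y₁) *
            gammaWeight ((n - s + 1 : ℕ) : ℝ) (s - r) j *
            paretoPDF ((m : ℝ) + α + 1)
              (((n - s + j + 1 : ℕ) : ℝ) / (x + β + ((n - r + i + 1 : ℕ) : ℝ) * y₁)) y₂) := by
  have hpos : 0 < ∑ k ∈ Finset.range (r - m), gammaWeight ((n - r + 1 : ℕ) : ℝ) (r - m) k *
      paretoPDF ((m : ℝ) + α) (((n - r + k + 1 : ℕ) : ℝ) / (x + β)) y₁ := by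
    convert sum_gammaWeight_mul_paretoPDF_pos (c := ((n - r + 1 : ℕ) : ℝ)) (d := r - m)
      (by positivity) (by omega) hmα hxβ hy₁ using 5
    push_cast
    ring
  rw [Finset.mul_sum]
  refine Finset.sum_congr rfl fun i _ => ?_
  rw [Finset.mul_sum]
  refine Finset.sum_congr rfl fun j _ => ?_
  rw [bivParetoPDF_eq_mul_paretoPDF (by positivity) (by positivity) hxβ hy₁ hy₂,
    mul_assoc (_ / Finset.sum _ _), ← mul_assoc (Finset.sum _ _),
    mul_div_cancel_of_imp' fun h => absurd h hpos.ne',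
    gammaWeight_natCast_add_one, gammaWeight_natCast_add_one,
    show n - r + (r - m) = n - m by omega, show n - s + (s - r) = n - r by omega,
    Nat.sub_right_comm (r - m), Nat.sub_right_comm (s - r), pow_add]
  have := Nat.factorial_ne_zero (n - r)
  field_simp
end
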